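/- arXiv:1501.07415 — 2 statements merged into one kernel-verified Lean document; each statement's English description precedes it below -/
import Mathlib

section
/- Let Y be a Banach space, T : ℓ² → Y a bounded linear operator, and define A : ℓ¹ → Y by A x = T x (using the embedding of ℓ¹ into ℓ²). Fix 1 < p < ∞, α > 0 and y^δ ∈ Y. Then the Tikhonov functional F(x) = (1/p)‖A x − y^δ‖_Y^p + α‖x‖_{ℓ¹} attains its infimum over ℓ¹, i.e., there exists x_α^δ ∈ ℓ¹ with F(x_α^δ) ≤ F(x) for all x ∈ ℓ¹. -/
open scoped ENNReal

noncomputable section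

/-- The space `ℓ¹` of absolutely summable real sequences. -/
abbrev ell1 : Type := lp (fun _ : ℕ => ℝ) 1

/-- The space `ℓ²` of square-summable real sequences. -/
abbrev ell2 : Type := lp (fun _ : ℕ => ℝ) 2

/-- The natural embedding `ℓ¹ → ℓ²`. -/
def incl12 (x : ell1) : ell2 :=
  ⟨(x : ℕ → ℝ), (lp.memℓp x).of_exponent_ge (by norm_num)⟩

open Filter Topology InnerProductSpace

/-- A series of nonnegative continuous functions is lower semicontinuous where it converges. -/
theorem lowerSemicontinuousOn_tsum_of_continuous {ι X : Type*} [TopologicalSpace X]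
    {f : ι → X → ℝ} (hf : ∀ i, Continuous (f i)) (hf₀ : ∀ i x, 0 ≤ f i x) {s : Set X}
    (hs : ∀ x ∈ s, Summable fun i => f i x) :
    LowerSemicontinuousOn (fun x => ∑' i, f i x) s := by
  intro x hx c hc
  obtain ⟨t, ht⟩ := ((hs x hx).hasSum.eventually (lt_mem_nhds hc)).exists
  have hcont : Continuous fun z => ∑ i ∈ t, f i z := continuous_finsetSum t fun i _ => hf i
  filter_upwards [nhdsWithin_le_nhds (hcont.continuousAt.eventually (lt_mem_nhds ht)),
    self_mem_nhdsWithin] with z hz hzs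
  exact hz.trans_le ((hs z hzs).sum_le_tsum t fun i _ => hf₀ i z)

/-- The vector of a Hilbert space representing an element of its weak dual. -/
def WeakDual.rieszVector {H : Type*} [NormedAddCommGroup H] [InnerProductSpace ℝ H]
    [CompleteSpace H] (d : WeakDual ℝ H) : H :=
  (toDual ℝ H).symm (WeakDual.toStrongDual d)

theorem WeakDual.inner_rieszVector {H : Type*} [NormedAddCommGroup H] [InnerProductSpace ℝ H]
    [CompleteSpace H] (d : WeakDual ℝ H) (v : H) : inner ℝ d.rieszVector v = d v :=
  toDual_symm_apply

/-- Continuous linear functionals are weakly continuous on a Hilbert space. -/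
theorem WeakDual.continuous_apply_rieszVector {H : Type*} [NormedAddCommGroup H]
    [InnerProductSpace ℝ H] [CompleteSpace H] (φ : StrongDual ℝ H) :
    Continuous fun d : WeakDual ℝ H => φ d.rieszVector := by
  have h : (fun d : WeakDual ℝ H => φ d.rieszVector) = fun d => d ((toDual ℝ H).symm φ) := by
    funext d
    rw [← WeakDual.inner_rieszVector, real_inner_comm, toDual_symm_apply]
  rw [h]
  exact WeakDual.eval_continuous _

/-- The residual norm of a bounded linear operator is weakly lower semicontinuous. -/
theorem WeakDual.lowerSemicontinuous_norm_apply_sub {H Y : Type*} [NormedAddCommGroup H]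
    [InnerProductSpace ℝ H] [CompleteSpace H] [NormedAddCommGroup Y] [NormedSpace ℝ Y]
    (T : H →L[ℝ] Y) (y : Y) :
    LowerSemicontinuous fun d : WeakDual ℝ H => ‖T d.rieszVector - y‖ := by
  intro d c hc
  obtain ⟨φ, hφ, hφd⟩ := exists_dual_vector'' ℝ (T d.rieszVector - y)
  have hcont : Continuous fun d : WeakDual ℝ H => φ (T d.rieszVector - y) := by
    simp only [map_sub]
    exact (WeakDual.continuous_apply_rieszVector (φ.comp T)).sub continuous_const
  have hlt : c < φ (T d.rieszVector - y) := by simpa [hφd] using hc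
  filter_upwards [hcont.continuousAt.eventually (lt_mem_nhds hlt)] with z hz
  calc c < φ (T z.rieszVector - y) := hz
    _ ≤ ‖φ (T z.rieszVector - y)‖ := le_abs_self _
    _ ≤ ‖T z.rieszVector - y‖ := by
      simpa using φ.le_of_opNorm_le hφ (T z.rieszVector - y)

theorem ell1_norm_eq_tsum (x : ell1) : ‖x‖ = ∑' i, |x i| := by
  rw [lp.norm_eq_tsum_rpow (by simp)]
  simp

theorem ell1_sum_abs_le_norm (x : ell1) (s : Finset ℕ) : ∑ i ∈ s, |x i| ≤ ‖x‖ := by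
  simpa using lp.sum_rpow_le_norm_rpow (p := 1) (by simp) x s

theorem norm_incl12_le (x : ell1) : ‖incl12 x‖ ≤ ‖x‖ := by
  refine lp.norm_le_of_forall_sum_le (by simp) (norm_nonneg x) fun s => ?_
  calc ∑ i ∈ s, ‖incl12 x i‖ ^ (2 : ℝ≥0∞).toReal = ∑ i ∈ s, |x i| ^ 2 := by simp [incl12]
    _ ≤ (∑ i ∈ s, |x i|) ^ 2 := Finset.sum_sq_le_sq_sum_of_nonneg fun i _ => abs_nonneg _
    _ ≤ ‖x‖ ^ 2 := by gcongr; exact ell1_sum_abs_le_norm x s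
    _ = ‖x‖ ^ (2 : ℝ≥0∞).toReal := by simp

/-- The image of the closed `ℓ¹`-ball of radius `R` in the weak dual of `ℓ²`. -/
def weakEll1Ball (R : ℝ) : Set (WeakDual ℝ ell2) :=
  {d | ‖d.rieszVector‖ ≤ R} ∩ ⋂ s : Finset ℕ, {d | ∑ i ∈ s, |d.rieszVector i| ≤ R}

theorem mem_weakEll1Ball {R : ℝ} {d : WeakDual ℝ ell2} :
    d ∈ weakEll1Ball R ↔
      ‖d.rieszVector‖ ≤ R ∧ ∀ s : Finset ℕ, ∑ i ∈ s, |d.rieszVector i| ≤ R := by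
  simp [weakEll1Ball]

theorem continuous_abs_rieszVector_apply (i : ℕ) :
    Continuous fun d : WeakDual ℝ ell2 => |d.rieszVector i| := by
  have h (d : WeakDual ℝ ell2) : d.rieszVector i = d (lp.single 2 i (1 : ℝ)) := by
    rw [← WeakDual.inner_rieszVector, lp.inner_single_right]
    simp
  simp only [h]
  exact (WeakDual.eval_continuous _).abs

theorem isCompact_weakEll1Ball (R : ℝ) : IsCompact (weakEll1Ball R) := by
  have hball : {d : WeakDual ℝ ell2 | ‖d.rieszVector‖ ≤ R} =
      WeakDual.toStrongDual ⁻¹' Metric.closedBall 0 R := by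
    ext d
    simp [WeakDual.rieszVector]
  rw [weakEll1Ball, hball]
  refine (WeakDual.isCompact_closedBall 0 R).inter_right ?_
  exact isClosed_iInter fun s => isClosed_le
    (continuous_finsetSum s fun i _ => continuous_abs_rieszVector_apply i) continuous_const

theorem exists_incl12_eq_of_mem_weakEll1Ball {R : ℝ} {d : WeakDual ℝ ell2}
    (hd : d ∈ weakEll1Ball R) : ∃ x : ell1, incl12 x = d.rieszVector :=
  ⟨⟨d.rieszVector, memℓp_gen' (C := R) (by simpa using (mem_weakEll1Ball.1 hd).2)⟩, rfl⟩

theorem exists_mem_weakEll1Ball_of_norm_le {R : ℝ} {x : ell1} (hx : ‖x‖ ≤ R) :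
    ∃ d ∈ weakEll1Ball R, d.rieszVector = incl12 x := by
  have h : (StrongDual.toWeakDual (toDual ℝ ell2 (incl12 x))).rieszVector = incl12 x :=
    (toDual ℝ ell2).symm_apply_apply _
  refine ⟨_, mem_weakEll1Ball.2 ?_, h⟩
  rw [h]
  exact ⟨(norm_incl12_le x).trans hx, fun s => (ell1_sum_abs_le_norm x s).trans hx⟩

/-- Existence of `ℓ¹`-regularized solutions: the Tikhonov functional
`F(x) = (1/p)‖A x − y^δ‖^p + α‖x‖_{ℓ¹}` with `A = T ∘ E₂` attains its infimum over `ℓ¹`. -/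
theorem exists_l1_Tikhonov_minimizer
    {Y : Type*} [NormedAddCommGroup Y] [NormedSpace ℝ Y] [CompleteSpace Y]
    (T : ell2 →L[ℝ] Y) (p : ℝ) (hp1 : 1 < p) (α : ℝ) (hα : 0 < α) (yδ : Y) :
    ∃ xmin : ell1, ∀ x : ell1,
      (1 / p) * ‖T (incl12 xmin) - yδ‖ ^ p + α * ‖xmin‖ ≤
        (1 / p) * ‖T (incl12 x) - yδ‖ ^ p + α * ‖x‖ := by
  have hp₀ : 0 < p := by linarith
  set R : ℝ := (1 / p) * ‖yδ‖ ^ p / α with hR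
  have hR₀ : 0 ≤ R := by positivity
  let G : WeakDual ℝ ell2 → ℝ := fun d =>
    (1 / p) * ‖T d.rieszVector - yδ‖ ^ p + α * ∑' i, |d.rieszVector i|
  have hG {d : WeakDual ℝ ell2} {x : ell1} (h : incl12 x = d.rieszVector) :
      G d = (1 / p) * ‖T (incl12 x) - yδ‖ ^ p + α * ‖x‖ := by
    simp only [G, ell1_norm_eq_tsum, ← h]
    rfl
  have hmisfit : LowerSemicontinuous fun d : WeakDual ℝ ell2 =>
      (1 / p) * ‖T d.rieszVector - yδ‖ ^ p := by
    have hcont : Continuous fun t : ℝ => (1 / p) * (max t 0) ^ p :=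
      continuous_const.mul
        ((continuous_id.max continuous_const).rpow_const fun _ => Or.inr hp₀.le)
    have hmono : Monotone fun t : ℝ => (1 / p) * (max t 0) ^ p := fun a b hab => by
      dsimp only
      gcongr
    convert! hcont.comp_lowerSemicontinuous
      (WeakDual.lowerSemicontinuous_norm_apply_sub T yδ) hmono using 2 with d
    simp
  have hpenalty : LowerSemicontinuousOn
      (fun d : WeakDual ℝ ell2 => α * ∑' i, |d.rieszVector i|) (weakEll1Ball R) :=
    (continuous_const.mul continuous_id).comp_lowerSemicontinuousOn
      (lowerSemicontinuousOn_tsum_of_continuous continuous_abs_rieszVector_apply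
        (fun _ _ => abs_nonneg _)
        fun d hd => summable_of_sum_le (fun _ => abs_nonneg _) (mem_weakEll1Ball.1 hd).2)
      (fun a b hab => mul_le_mul_of_nonneg_left hab hα.le)
  obtain ⟨d₀, hd₀, hd₀R⟩ : ∃ d ∈ weakEll1Ball R, d.rieszVector = incl12 0 :=
    exists_mem_weakEll1Ball_of_norm_le (by simpa using hR₀)
  obtain ⟨d, hd, hmin⟩ := LowerSemicontinuousOn.exists_isMinOn ⟨d₀, hd₀⟩
    (isCompact_weakEll1Ball R) ((hmisfit.lowerSemicontinuousOn _).add hpenalty)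
  obtain ⟨x₀, hx₀⟩ := exists_incl12_eq_of_mem_weakEll1Ball hd
  refine ⟨x₀, fun x => ?_⟩
  rw [← hG hx₀]
  rcases le_total ‖x‖ R with hx | hx
  · obtain ⟨e, he, hex⟩ := exists_mem_weakEll1Ball_of_norm_le hx
    rw [← hG hex.symm]
    exact hmin he
  · have hzero : incl12 0 = 0 := rfl
    calc G d ≤ G d₀ := hmin hd₀
      _ = α * R := by
        rw [hG hd₀R.symm, hzero, hR]
        simp
        field_simp
      _ ≤ α * ‖x‖ := by gcongr
      _ ≤ _ := le_add_of_nonneg_left (by positivity)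
end
end

section
/- Let 1 < q < ∞ and let E_q : ℓ¹ → ℓ^q denote the embedding operator (every x ∈ ℓ¹ lies in ℓ^q). Then for every x† ∈ ℓ¹ the variational inequality ‖x − x†‖_{ℓ¹} ≤ ‖x‖_{ℓ¹} − ‖x†‖_{ℓ¹} + 2 inf_{n∈ℕ, n≥1} ( Σ_{k=n+1}^∞ |x†_k| + n^{1−1/q} · ‖x − x†‖_{ℓ^q} ) holds for all x ∈ ℓ¹. -/
open scoped ENNReal

noncomputable section

/-- Triangle inequality for absolutely summable sequences with a head/tail splitting at `n`. -/
lemma tsum_abs_sub_le_head_add_tail {a b : ℕ → ℝ} (ha : Summable fun k => |a k|)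
    (hb : Summable fun k => |b k|) (n : ℕ) :
    ∑' k, |a k - b k| ≤ ∑' k, |a k| - ∑' k, |b k| +
      2 * (∑' k, |b (k + n)| + ∑ k ∈ Finset.range n, |a k - b k|) := by
  have hab : Summable fun k => |a k - b k| :=
    Summable.of_nonneg_of_le (fun _ => abs_nonneg _) (fun k => abs_sub (a k) (b k)) (ha.add hb)
  have ha' := (summable_nat_add_iff n).2 ha
  have hb' := (summable_nat_add_iff n).2 hb
  have hab' := (summable_nat_add_iff n).2 hab
  have tail : ∑' k, |a (k + n) - b (k + n)| ≤ ∑' k, |a (k + n)| + ∑' k, |b (k + n)| := by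
    rw [← ha'.tsum_add hb']
    exact hab'.tsum_le_tsum (fun k => abs_sub _ _) (ha'.add hb')
  have head : ∑ k ∈ Finset.range n, |b k| ≤
      ∑ k ∈ Finset.range n, |a k| + ∑ k ∈ Finset.range n, |a k - b k| := by
    rw [← Finset.sum_add_distrib]
    refine Finset.sum_le_sum fun k _ => ?_
    have := abs_sub_abs_le_abs_sub (b k) (a k)
    rw [abs_sub_comm] at this
    linarith
  rw [← ha.sum_add_tsum_nat_add n, ← hb.sum_add_tsum_nat_add n, ← hab.sum_add_tsum_nat_add n]
  linarith

/-- Hölder's inequality between the `ℓ¹` norm of an initial segment and the `ℓ^q` norm. -/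
lemma sum_range_abs_le_rpow_mul_tsum {q : ℝ} (hq : 1 ≤ q) {f : ℕ → ℝ}
    (hf : Summable fun k => |f k| ^ q) (n : ℕ) :
    ∑ k ∈ Finset.range n, |f k| ≤ (n : ℝ) ^ (1 - 1 / q) * (∑' k, |f k| ^ q) ^ (1 / q) := by
  have hq0 : 0 < q := by linarith
  have hT : 0 ≤ ∑' k, |f k| ^ q := tsum_nonneg fun k => by positivity
  have holder := Real.rpow_sum_le_const_mul_sum_rpow (Finset.range n) f hq
  rw [Finset.card_range] at holder
  have h : (∑ k ∈ Finset.range n, |f k|) ^ q ≤ (n : ℝ) ^ (q - 1) * ∑' k, |f k| ^ q :=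
    holder.trans (mul_le_mul_of_nonneg_left
      (hf.sum_le_tsum _ fun k _ => by positivity) (by positivity))
  have hroot := Real.rpow_le_rpow (by positivity) h (by positivity : 0 ≤ 1 / q)
  rw [← Real.rpow_mul (by positivity), mul_one_div_cancel hq0.ne', Real.rpow_one,
    Real.mul_rpow (by positivity) hT, ← Real.rpow_mul (by positivity)] at hroot
  rwa [show (q - 1) * (1 / q) = 1 - 1 / q by field_simp] at hroot

lemma ell1.summable_abs (x : ell1) : Summable fun k => |(x : ℕ → ℝ) k| := by
  simpa using (lp.memℓp x).summable (by simp)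

lemma ell1.norm_eq_tsum_abs (x : ell1) : ‖x‖ = ∑' k, |(x : ℕ → ℝ) k| := by
  simpa using lp.norm_eq_tsum_rpow (by simp) x

lemma ell1.summable_abs_rpow {q : ℝ} (hq : 1 ≤ q) (x : ell1) :
    Summable fun k => |(x : ℕ → ℝ) k| ^ q := by
  have h : Memℓp (x : ℕ → ℝ) (ENNReal.ofReal q) :=
    (lp.memℓp x).of_exponent_ge (by simpa using hq)
  have hq0 : 0 ≤ q := by linarith
  simpa [ENNReal.toReal_ofReal hq0] using
    h.summable (by rw [ENNReal.toReal_ofReal hq0]; linarith)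

/-- Variational inequality with the improved index function `φ₂` for the denoising problem
with the embedding operator `E_q : ℓ¹ → ℓ^q`, `1 < q < ∞`:
`‖x − x†‖₁ ≤ ‖x‖₁ − ‖x†‖₁ + 2 inf_{n≥1} (Σ_{k≥n} |x†_k| + n^{1−1/q} ‖x − x†‖_{ℓ^q})`,
where `‖z‖_{ℓ^q} = (Σ_k |z_k|^q)^{1/q}`. -/
theorem variational_inequality_denoising_lq
    (q : ℝ) (hq : 1 < q) (xdag x : ell1) :
    ‖x - xdag‖ ≤ ‖x‖ - ‖xdag‖ +
      2 * ⨅ n : {m : ℕ // 1 ≤ m},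
        ((∑' k : ℕ, |(xdag : ℕ → ℝ) (k + n.1)|) +
          (n.1 : ℝ) ^ (1 - 1 / q) *
            (∑' k : ℕ, |(x : ℕ → ℝ) k - (xdag : ℕ → ℝ) k| ^ q) ^ (1 / q)) := by
  have : Nonempty {m : ℕ // 1 ≤ m} := ⟨⟨1, le_rfl⟩⟩
  suffices h : (‖x - xdag‖ - (‖x‖ - ‖xdag‖)) / 2 ≤ ⨅ n : {m : ℕ // 1 ≤ m},
      ((∑' k : ℕ, |(xdag : ℕ → ℝ) (k + n.1)|) +
        (n.1 : ℝ) ^ (1 - 1 / q) *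
          (∑' k : ℕ, |(x : ℕ → ℝ) k - (xdag : ℕ → ℝ) k| ^ q) ^ (1 / q)) by linarith
  refine le_ciInf fun n => ?_
  have split := tsum_abs_sub_le_head_add_tail (ell1.summable_abs x) (ell1.summable_abs xdag) n.1
  have holder := sum_range_abs_le_rpow_mul_tsum hq.le (ell1.summable_abs_rpow hq.le (x - xdag)) n.1
  simp only [lp.coeFn_sub, Pi.sub_apply] at holder
  simp only [ell1.norm_eq_tsum_abs, lp.coeFn_sub, Pi.sub_apply]
  linarith
end
end
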